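/- Let G be a finite abelian group and let T_1, …, T_s be subgroups of G. Let S be the ideal of the integral group ring ℤ[G] generated by the norm elements s(T_1), …, s(T_s). Then the rank of S as a ℤ-module equals Σ_{∅ ≠ I ⊆ {1,…,s}} (−1)^{#I+1} [G : T_I], where for each nonempty subset I ⊆ {1,…,s}, T_I denotes the subgroup of G generated by the T_i with i ∈ I, and [G : T_I] is its index. -/

import Mathlib

set_option maxHeartbeats 1000000

/-- The norm element `s(T) = Σ_{t ∈ T} t` of a subgroup `T`, in the integral group ring. -/
noncomputable def sElt {G : Type} [Group G] [Finite G] (T : Subgroup G) :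
    MonoidAlgebra ℤ G :=
  letI : Fintype T := Fintype.ofFinite _
  ∑ t : T, MonoidAlgebra.of ℤ G (t : G)

open MonoidAlgebra

/-- If `e` lies in the ideal `S` and acts on `S` as the scalar `n`, then multiplication by `e` on
the whole algebra has trace `n * rank S`. -/
theorem Ideal.trace_eq_mul_finrank {R A : Type*} [CommRing R] [IsDomain R] [IsPrincipalIdealRing R]
    [CommRing A] [Algebra R A] [Module.Free R A] [Module.Finite R A]
    (S : Ideal A) {e : A} (he : e ∈ S) {n : R} (hn : ∀ x ∈ S, e * x = n • x) :
    Algebra.trace R A e = n * Module.finrank R S := by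
  let S' : Submodule R A := S.restrictScalars R
  let f : A →ₗ[R] S' := (LinearMap.mulLeft R e).codRestrict S' fun x => S.mul_mem_right x he
  have hf : S'.subtype ∘ₗ f = Algebra.lmul R A e := by
    ext x
    rfl
  have hS' : f ∘ₗ S'.subtype = n • LinearMap.id := by
    ext x
    exact hn x x.2
  have : Module.finrank R S' = Module.finrank R S := rfl
  rw [Algebra.trace_apply, ← hf, LinearMap.trace_comp_comm', hS', map_smul, LinearMap.trace_id,
    smul_eq_mul, this]

theorem MonoidAlgebra.trace_eq_card_mul_coeff_one {R G : Type*} [CommRing R] [CommGroup G]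
    [Fintype G] (x : MonoidAlgebra R G) :
    Algebra.trace R (MonoidAlgebra R G) x = Fintype.card G * x.coeff 1 := by
  classical
  rw [Algebra.trace_eq_matrix_trace (MonoidAlgebra.basis G R), Matrix.trace]
  simp [Algebra.leftMulMatrix_eq_repr_mul, MonoidAlgebra.basis]

section NormElement

variable {G : Type} [CommGroup G] [Finite G]

theorem of_mul_sElt {T : Subgroup G} {t : G} (ht : t ∈ T) : of ℤ G t * sElt T = sElt T := by
  let _ : Fintype T := Fintype.ofFinite _
  simp only [sElt, Finset.mul_sum, ← map_mul]
  exact Fintype.sum_equiv (Equiv.mulLeft (⟨t, ht⟩ : T)) _ _ fun _ => rfl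

theorem sElt_mul_of_forall_of_mul {T : Subgroup G} {x : MonoidAlgebra ℤ G}
    (hx : ∀ t ∈ T, of ℤ G t * x = x) : sElt T * x = Nat.card T * x := by
  let _ : Fintype T := Fintype.ofFinite _
  rw [sElt, Finset.sum_mul, Finset.sum_congr rfl fun (t : T) _ => hx t t.2]
  simp [Nat.card_eq_fintype_card]

theorem sElt_mul_sElt_of_le {H K : Subgroup G} (h : H ≤ K) :
    sElt H * sElt K = Nat.card H * sElt K :=
  sElt_mul_of_forall_of_mul fun _ ht => of_mul_sElt (h ht)

theorem coeff_one_sElt (T : Subgroup G) : (sElt T).coeff 1 = 1 := by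
  classical
  let _ : Fintype T := Fintype.ofFinite _
  simp [sElt, coeff_sum, Finsupp.single_apply]

variable {ι : Type*} (T : ι → Subgroup G) (I : Finset ι)

theorem of_mul_prod_sElt {t : G} (ht : t ∈ ⨆ i ∈ I, T i) :
    of ℤ G t * ∏ i ∈ I, sElt (T i) = ∏ i ∈ I, sElt (T i) := by
  classical
  let P := ∏ i ∈ I, sElt (T i)
  let stab : Subgroup G :=
    { carrier := {t | of ℤ G t * P = P}
      one_mem' := by rw [Set.mem_ofPred_eq, map_one, one_mul]
      mul_mem' := fun {a b} ha hb => by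
        simp only [Set.mem_ofPred_eq] at *
        rw [map_mul, mul_assoc, hb, ha]
      inv_mem' := fun {a} ha => by
        simp only [Set.mem_ofPred_eq] at *
        conv_lhs => rw [← ha]
        rw [← mul_assoc, ← map_mul, inv_mul_cancel, map_one, one_mul] }
  have hle : ⨆ i ∈ I, T i ≤ stab := iSup₂_le fun i hi t ht => by
    change of ℤ G t * ∏ i ∈ I, sElt (T i) = ∏ i ∈ I, sElt (T i)
    rw [← Finset.mul_prod_erase I _ hi, ← mul_assoc, of_mul_sElt ht]
  exact hle ht

theorem card_iSup_mul_prod_sElt :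
    (Nat.card ↥(⨆ i ∈ I, T i) : MonoidAlgebra ℤ G) * ∏ i ∈ I, sElt (T i) =
      (∏ i ∈ I, (Nat.card (T i) : MonoidAlgebra ℤ G)) * sElt (⨆ i ∈ I, T i) := by
  classical
  rw [← sElt_mul_of_forall_of_mul fun t ht => of_mul_prod_sElt T I ht, mul_comm]
  have key : ∀ J ⊆ I, (∏ i ∈ J, sElt (T i)) * sElt (⨆ i ∈ I, T i) =
      (∏ i ∈ J, (Nat.card (T i) : MonoidAlgebra ℤ G)) * sElt (⨆ i ∈ I, T i) := by
    intro J
    induction J using Finset.induction_on with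
    | empty => simp
    | insert a J ha ih =>
      intro hJ
      rw [Finset.insert_subset_iff] at hJ
      rw [Finset.prod_insert ha, Finset.prod_insert ha, mul_assoc, ih hJ.2, mul_left_comm,
        sElt_mul_sElt_of_le (le_iSup₂ (f := fun i (_ : i ∈ I) => T i) a hJ.1)]
      ring
  exact key I subset_rfl

theorem trace_prod_sElt :
    Algebra.trace ℤ (MonoidAlgebra ℤ G) (∏ i ∈ I, sElt (T i)) =
      (∏ i ∈ I, (Nat.card (T i) : ℤ)) * ((⨆ i ∈ I, T i).index : ℤ) := by
  let _ : Fintype G := Fintype.ofFinite _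
  set H := ⨆ i ∈ I, T i
  have hcard : (Nat.card H : ℤ) ≠ 0 := by exact_mod_cast Nat.card_pos.ne'
  have key : (Nat.card H : ℤ) • ∏ i ∈ I, sElt (T i) =
      (∏ i ∈ I, (Nat.card (T i) : ℤ)) • sElt H := by
    simpa [zsmul_eq_mul] using card_iSup_mul_prod_sElt T I
  have htr := congrArg (Algebra.trace ℤ (MonoidAlgebra ℤ G)) key
  rw [map_smul, map_smul, trace_eq_card_mul_coeff_one (sElt H), coeff_one_sElt, mul_one,
    ← Nat.card_eq_fintype_card, ← H.card_mul_index, smul_eq_mul, smul_eq_mul] at htr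
  apply mul_left_cancel₀ hcard
  rw [htr]
  push_cast
  ring

end NormElement

/-- Let `G` be a finite abelian group, `T_1, …, T_s ≤ G` subgroups, and `S` the ideal of
`ℤ[G]` generated by the norm elements `s(T_1), …, s(T_s)`.  Then the `ℤ`-rank of `S` is
`Σ_{∅ ≠ I ⊆ {1,…,s}} (-1)^{#I+1} [G : T_I]`, where `T_I` is the subgroup generated by
the `T_i` with `i ∈ I`. -/
theorem stmt_9 {G : Type} [CommGroup G] [Fintype G]
    (s : ℕ) (T : Fin s → Subgroup G)
    (S : Ideal (MonoidAlgebra ℤ G))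
    (hS : S = Ideal.span (Set.range fun i => sElt (T i))) :
    (Module.finrank ℤ S : ℤ) =
      ∑ I ∈ Finset.univ.powerset.filter (fun I : Finset (Fin s) => I ≠ ∅),
        (-1 : ℤ) ^ (I.card + 1) * ((⨆ i ∈ I, T i).index : ℤ) := by
  classical
  let c : Fin s → ℤ := fun i => Nat.card (T i)
  let N : ℤ := ∏ i, c i
  have hN : N ≠ 0 := Finset.prod_ne_zero_iff.mpr fun i _ => by
    exact Nat.cast_ne_zero.mpr Nat.card_pos.ne'
  let F : MonoidAlgebra ℤ G := ∏ i, ((c i : MonoidAlgebra ℤ G) - sElt (T i))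
  have hgen : ∀ i, sElt (T i) ∈ S := fun i => hS ▸ Ideal.subset_span ⟨i, rfl⟩
  have hmem : (N : MonoidAlgebra ℤ G) - F ∈ S := by
    rw [← Ideal.Quotient.eq]
    simp [N, F, map_prod, Ideal.Quotient.eq_zero_iff_mem.mpr (hgen _)]
  have hF : ∀ x ∈ S, F * x = 0 := by
    intro x hx
    rw [hS] at hx
    induction hx using Submodule.span_induction with
    | mem x hx =>
      obtain ⟨i, rfl⟩ := hx
      have : ((c i : MonoidAlgebra ℤ G) - sElt (T i)) * sElt (T i) = 0 := by
        rw [sub_mul, sElt_mul_sElt_of_le le_rfl]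
        simp [c]
      simp only [F]
      rw [← Finset.prod_erase_mul _ _ (Finset.mem_univ i), mul_assoc, this, mul_zero]
    | zero => simp
    | add x y _ _ hx hy => rw [mul_add, hx, hy, add_zero]
    | smul a x _ hx => rw [smul_eq_mul, mul_left_comm, hx, mul_zero]
  have hrank := S.trace_eq_mul_finrank hmem (n := N) fun x hx => by
    rw [sub_mul, hF x hx, sub_zero, zsmul_eq_mul]
  have hterm : ∀ I : Finset (Fin s), Algebra.trace ℤ (MonoidAlgebra ℤ G)
      ((-1) ^ I.card * (∏ i ∈ Finset.univ \ I, (c i : MonoidAlgebra ℤ G)) *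
        ∏ i ∈ I, sElt (T i)) = N * ((-1) ^ I.card * ((⨆ i ∈ I, T i).index : ℤ)) := by
    intro I
    have h : (-1) ^ I.card * (∏ i ∈ Finset.univ \ I, (c i : MonoidAlgebra ℤ G)) *
        ∏ i ∈ I, sElt (T i) =
        ((-1) ^ I.card * ∏ i ∈ Finset.univ \ I, c i) • ∏ i ∈ I, sElt (T i) := by
      rw [zsmul_eq_mul]
      push_cast
      ring
    rw [h, map_smul, trace_prod_sElt, smul_eq_mul]
    simp only [N]
    rw [← Finset.prod_sdiff (Finset.subset_univ I)]
    ring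
  have htN : Algebra.trace ℤ (MonoidAlgebra ℤ G) (N : MonoidAlgebra ℤ G) =
      N * ((⨆ i ∈ (∅ : Finset (Fin s)), T i).index : ℤ) := by
    have := trace_prod_sElt T ∅
    rw [Finset.prod_empty, Finset.prod_empty, one_mul] at this
    rw [← this, ← smul_eq_mul, ← map_smul, zsmul_eq_mul, mul_one]
  apply mul_left_cancel₀ hN
  rw [← hrank, map_sub, htN]
  simp only [F]
  rw [Finset.prod_sub, map_sum, Finset.sum_congr rfl fun I _ => hterm I, Finset.filter_ne',
    ← Finset.add_sum_erase _ _ (Finset.mem_powerset.mpr (Finset.empty_subset _)),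
    Finset.mul_sum, Finset.card_empty, pow_zero, one_mul, sub_add_cancel_left,
    ← Finset.sum_neg_distrib]
  exact Finset.sum_congr rfl fun I _ => by ring
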